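/- arXiv:2507.22774 — 2 statements merged into one kernel-verified Lean document; each statement's English description precedes it below -/
import Mathlib

section
/- Let P be a head-cycle-free propositional ASP program, let r ∈ P be either a disjunctive rule with H(r) = {a} or a choice rule with a ∈ H(r), where B(r) is a normal body and SCC_P(a) ∩ B⁺(r) ≠ ∅, and let ⟨I, δ⟩ be a model of Tr(P). Then bd_r^a ∈ I if and only if both I ⊨ B(r) and δ(ℓ_a) > max{ δ(ℓ_b) : b ∈ B⁺(r) ∩ SCC_P(a) }. -/
/-!
Common framework: propositional ASP programs (disjunctive/choice heads,
normal/weighted bodies), FLP answer sets, dependency graph and SCCs,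
(modular) ranked (scc-)supported models, and the asp-fzn translation `Tr(P)`.
-/

namespace AspFzn

open scoped Classical

/-- A rule `H(r) ← B(r)`.  The head is the finite set `headAtoms`, read as a
choice head if `isChoice = true` and as a disjunctive head otherwise
(a constraint rule when moreover `headAtoms = ∅`).  The body is given by
`bodyPos` (positive literals) and `bodyNeg` (negated literals); it is a
weighted body with lower bound `lb` and weights `wPos`/`wNeg` when
`isWeighted = true`, and a normal body otherwise. -/
structure Rule (α : Type) where
  headAtoms : Finset α
  isChoice : Bool
  bodyPos : Finset α
  bodyNeg : Finset α
  isWeighted : Bool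
  wPos : α → ℤ
  wNeg : α → ℤ
  lb : ℤ

/-- A propositional ASP program: a finite list of rules over the finite
set `atoms` (= `A_P`) of propositional atoms. -/
structure Program (α : Type) where
  rules : List (Rule α)
  atoms : Finset α
  wf : ∀ r ∈ rules, r.headAtoms ⊆ atoms ∧ r.bodyPos ⊆ atoms ∧ r.bodyNeg ⊆ atoms

variable {α : Type} [DecidableEq α]

/-- `r` is a constraint rule: a disjunctive rule with empty head. -/
def Rule.isConstraintRule (r : Rule α) : Prop :=
  r.isChoice = false ∧ r.headAtoms = ∅

/-- Satisfaction of a normal body by interpretation `I`. -/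
def normalBodySat (I : Finset α) (r : Rule α) : Prop :=
  r.bodyPos ⊆ I ∧ ∀ b ∈ r.bodyNeg, b ∉ I

/-- Value `Σ_{b ∈ B⁺(r) ∩ I} w_b^r + Σ_{b ∈ B⁻(r) \ I} w_b^r` of a weighted body. -/
def weightedVal (I : Finset α) (r : Rule α) : ℤ :=
  (∑ b ∈ r.bodyPos.filter (· ∈ I), r.wPos b) +
  (∑ b ∈ r.bodyNeg.filter (· ∉ I), r.wNeg b)

/-- `I ⊨ B(r)`. -/
def bodySat (I : Finset α) (r : Rule α) : Prop :=
  if r.isWeighted then r.lb ≤ weightedVal I r else normalBodySat I r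

/-- `I ⊨ H(r)`: every choice head is satisfied; a disjunctive head needs a true disjunct. -/
def headSat (I : Finset α) (r : Rule α) : Prop :=
  r.isChoice = true ∨ ∃ a ∈ r.headAtoms, a ∈ I

/-- `I ⊨ r`. -/
def ruleSat (I : Finset α) (r : Rule α) : Prop :=
  bodySat I r → headSat I r

/-- `I ⊨ P`. -/
def progSat (I : Finset α) (P : Program α) : Prop :=
  ∀ r ∈ P.rules, ruleSat I r

/-- `J` satisfies the FLP reduct `P^I`. -/
def reductSat (P : Program α) (I J : Finset α) : Prop :=
  ∀ r ∈ P.rules, bodySat I r →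
    if r.isChoice then
      ∀ a ∈ r.headAtoms, a ∈ I →
        ((if r.isWeighted then
            max 0 (r.lb - ∑ b ∈ r.bodyNeg.filter (· ∉ I), r.wNeg b)
              ≤ ∑ b ∈ r.bodyPos.filter (· ∈ J), r.wPos b
          else r.bodyPos ⊆ J) → a ∈ J)
    else
      (bodySat J r → ∃ a ∈ r.headAtoms, a ∈ J)

/-- `I ∈ AS(P)`: `I` is a ⊆-minimal model of the FLP reduct `P^I`. -/
def isAnswerSet (P : Program α) (I : Finset α) : Prop :=
  I ⊆ P.atoms ∧ reductSat P I I ∧ ∀ J ⊆ I, reductSat P I J → J = I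

/-- Edge `(a, b)` of the positive dependency graph `DG⁺_P`. -/
def edge (P : Program α) (a b : α) : Prop :=
  ∃ r ∈ P.rules, a ∈ r.headAtoms ∧ b ∈ r.bodyPos

/-- `a` and `b` lie in the same strongly connected component of `DG⁺_P`. -/
def sameSCC (P : Program α) (a b : α) : Prop :=
  Relation.ReflTransGen (edge P) a b ∧ Relation.ReflTransGen (edge P) b a

/-- `SCC_P(a)`, as a finite subset of `A_P`. -/
noncomputable def scc (P : Program α) (a : α) : Finset α :=
  P.atoms.filter (fun b => sameSCC P a b)

/-- `P` is head-cycle free. -/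
def isHCF (P : Program α) : Prop :=
  ∀ r ∈ P.rules, ∀ a ∈ r.headAtoms, ∀ b ∈ r.headAtoms, a ≠ b → b ∉ scc P a

/-- `r` is partially shifted (w.r.t. program `P`). -/
def Rule.partiallyShifted (r : Rule α) (P : Program α) : Prop :=
  r.isWeighted = false ∨ r.headAtoms.card ≤ 1 ∨
    ∀ a ∈ r.bodyPos, ∀ h ∈ r.headAtoms, h ∉ scc P a

/-- `P` is partially shifted. -/
def isPartiallyShifted (P : Program α) : Prop :=
  ∀ r ∈ P.rules, r.partiallyShifted P

/-- `P` has no tautological rules, i.e. `DG⁺_P` has no self-loops. -/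
def noSelfLoops (P : Program α) : Prop :=
  ∀ a, ¬ edge P a a

/-! ### Ranked interpretations and (scc-)support -/

/-- `⟨I, δ⟩` is a ranked interpretation: `δ(ℓ_a) = ∞` iff `a ∉ I`. -/
def isRanked (P : Program α) (I : Finset α) (δ : α → WithTop ℤ) : Prop :=
  ∀ a ∈ P.atoms, (δ a = ⊤ ↔ a ∉ I)

/-- `Σ_{b ∈ B⁺(r), δ(ℓ_b) < δ(ℓ_a)} w_b^r + Σ_{b ∈ B⁻(r) \ I} w_b^r`. -/
noncomputable def supWeight (I : Finset α) (δ : α → WithTop ℤ) (r : Rule α) (a : α) : ℤ :=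
  (∑ b ∈ r.bodyPos.filter (fun b => δ b < δ a), r.wPos b) +
  (∑ b ∈ r.bodyNeg.filter (· ∉ I), r.wNeg b)

/-- Rule `r` supports atom `a ∈ I` in the ranked interpretation `⟨I, δ⟩`. -/
def supports (I : Finset α) (δ : α → WithTop ℤ) (r : Rule α) (a : α) : Prop :=
  a ∈ r.headAtoms ∧
  (r.isChoice = false → r.headAtoms ∩ I = {a}) ∧
  (if r.isWeighted then r.lb ≤ supWeight I δ r a
   else (∀ b ∈ r.bodyPos, δ b < δ a) ∧ ∀ b ∈ r.bodyNeg, b ∉ I)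

/-- `⟨I, δ⟩` is a ranked supported model of `P`. -/
def isRankedSupportedModel (P : Program α) (I : Finset α) (δ : α → WithTop ℤ) : Prop :=
  I ⊆ P.atoms ∧ isRanked P I δ ∧ progSat I P ∧
  ∀ a ∈ I, ∃ r ∈ P.rules, supports I δ r a

/-- `Σ_{b ∈ (B⁺(r) ∩ I) \ SCC_P(a)} w_b^r
   + Σ_{b ∈ B⁺(r) ∩ SCC_P(a), δ(ℓ_b) < δ(ℓ_a)} w_b^r
   + Σ_{b ∈ B⁻(r) \ I} w_b^r`. -/
noncomputable def sccSupWeight (P : Program α) (I : Finset α) (δ : α → WithTop ℤ)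
    (r : Rule α) (a : α) : ℤ :=
  (∑ b ∈ (r.bodyPos.filter (· ∈ I)).filter (fun b => b ∉ scc P a), r.wPos b) +
  (∑ b ∈ (r.bodyPos.filter (fun b => b ∈ scc P a)).filter (fun b => δ b < δ a), r.wPos b) +
  (∑ b ∈ r.bodyNeg.filter (· ∉ I), r.wNeg b)

/-- Rule `r` scc-supports atom `a ∈ I` in the ranked interpretation `⟨I, δ⟩`. -/
def sccSupports (P : Program α) (I : Finset α) (δ : α → WithTop ℤ)
    (r : Rule α) (a : α) : Prop :=
  a ∈ r.headAtoms ∧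
  (r.isChoice = false → r.headAtoms ∩ I = {a}) ∧
  (if r.isWeighted then r.lb ≤ sccSupWeight P I δ r a
   else (∀ b ∈ r.bodyPos, b ∈ I) ∧ (∀ b ∈ r.bodyPos, b ∈ scc P a → δ b < δ a) ∧
        ∀ b ∈ r.bodyNeg, b ∉ I)

/-- `⟨I, δ⟩` is modular: `δ(ℓ_a) ≤ |SCC_P(a)|` for every `a ∈ I`. -/
def isModular (P : Program α) (I : Finset α) (δ : α → WithTop ℤ) : Prop :=
  ∀ a ∈ I, δ a ≤ (((scc P a).card : ℤ) : WithTop ℤ)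

/-- `⟨I, δ⟩` is a modular ranked scc-supported model of `P`. -/
def isModularRankedSccSupportedModel (P : Program α) (I : Finset α)
    (δ : α → WithTop ℤ) : Prop :=
  I ⊆ P.atoms ∧ isRanked P I δ ∧ isModular P I δ ∧ progSat I P ∧
  ∀ a ∈ I, ∃ r ∈ P.rules, sccSupports P I δ r a

/-! ### The translation `Tr(P)` -/

/-- The Boolean variables of the translation.  Rules are identified by their
index in `P.rules`. -/
inductive TrVar (α : Type) where
  | atom : α → TrVar α            -- one Boolean variable per atom of `A_P`
  | dep : α → α → TrVar α         -- `dep_{a,b}`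
  | yv : α → α → TrVar α          -- `y_{a,b}`
  | gap : α → α → TrVar α         -- `gap_{a,b}`
  | bd : ℕ → TrVar α              -- `bd_r`
  | bda : ℕ → α → TrVar α         -- `bd_r^a`
  | sp : ℕ → α → TrVar α          -- `sp_r^a`
  | ext : ℕ → α → TrVar α         -- `ext_r^a`
  | intv : ℕ → α → TrVar α        -- `int_r^a`
  | auxv : ℕ → α → TrVar α        -- `aux_r^a`

/-- 0-1 value of a Boolean variable in a linear sum. -/
noncomputable def b01 (p : Prop) : ℤ := if p then 1 else 0

/-- `s_a = |SCC_P(a)| + 1`. -/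
noncomputable def sVal (P : Program α) (a : α) : ℤ := ((scc P a).card : ℤ) + 1

/-- The locally tight head atoms `T = {a ∈ H(r) : SCC_P(a) ∩ B⁺(r) = ∅}`. -/
noncomputable def tightHeads (P : Program α) (r : Rule α) : Finset α :=
  r.headAtoms.filter (fun a => ∀ b ∈ r.bodyPos, b ∉ scc P a)

/-- `Σ_{b ∈ S} b · w_b` (a true Boolean atom variable counts as 1). -/
noncomputable def wSumPosV (V : Set (TrVar α)) (S : Finset α) (w : α → ℤ) : ℤ :=
  ∑ b ∈ S.filter (fun b => TrVar.atom b ∈ V), w b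

/-- `Σ_{b ∈ S} (¬b) · w_b` (a false Boolean atom variable makes `¬b` count as 1). -/
noncomputable def wSumNegV (V : Set (TrVar α)) (S : Finset α) (w : α → ℤ) : ℤ :=
  ∑ b ∈ S.filter (fun b => TrVar.atom b ∉ V), w b

/-- Sum for external support: `Σ_{b∈B⁺(r)\SCC_P(a)} b·w_b^r + Σ_{b∈B⁻(r)} (¬b)·w_b^r`. -/
noncomputable def extSum (P : Program α) (V : Set (TrVar α)) (r : Rule α) (a : α) : ℤ :=
  wSumPosV V (r.bodyPos.filter (fun b => b ∉ scc P a)) r.wPos +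
  wSumNegV V r.bodyNeg r.wNeg

/-- Sum for internal support, using the `dep_{a,b}` variables on `B⁺(r) ∩ SCC_P(a)`. -/
noncomputable def intSum (P : Program α) (V : Set (TrVar α)) (r : Rule α) (a : α) : ℤ :=
  wSumPosV V (r.bodyPos.filter (fun b => b ∉ scc P a)) r.wPos +
  (∑ b ∈ (r.bodyPos.filter (fun b => b ∈ scc P a)).filter
        (fun b => TrVar.dep a b ∈ V), r.wPos b) +
  wSumNegV V r.bodyNeg r.wNeg

/-- Sum for the gap constraint, using the `gap_{a,b}` variables on `B⁺(r) ∩ SCC_P(a)`. -/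
noncomputable def gapSum (P : Program α) (V : Set (TrVar α)) (r : Rule α) (a : α) : ℤ :=
  wSumPosV V (r.bodyPos.filter (fun b => b ∉ scc P a)) r.wPos +
  (∑ b ∈ (r.bodyPos.filter (fun b => b ∈ scc P a)).filter
        (fun b => TrVar.gap a b ∈ V), r.wPos b) +
  wSumNegV V r.bodyNeg r.wNeg

/-- Domain constraints of the integer variables `ℓ_a ∈ [1, s_a]`
(introduced for atoms `a` with `|SCC_P(a)| > 1`). -/
def levDomOK (P : Program α) (δ : α → ℤ) : Prop :=
  ∀ a ∈ P.atoms, 1 < (scc P a).card → 1 ≤ δ a ∧ δ a ≤ sVal P a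

/-- Satisfaction of the ranking constraints `TrRk(P)`. -/
def TrRkSat (P : Program α) (V : Set (TrVar α)) (δ : α → ℤ) : Prop :=
  ∀ a ∈ P.atoms, 1 < (scc P a).card →
    ((δ a ≤ ((scc P a).card : ℤ) ↔ TrVar.atom a ∈ V) ∧
     ∀ b ∈ scc P a, edge P a b →
       ((1 ≤ δ a - δ b ↔ TrVar.dep a b ∈ V) ∧
        (2 ≤ δ a - δ b ↔ TrVar.yv a b ∈ V) ∧
        ((TrVar.atom a ∈ V ∧ TrVar.atom b ∈ V ∧ TrVar.yv a b ∈ V) ↔ TrVar.gap a b ∈ V)))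

/-- Satisfaction of the body translation `TrBd(r)` for the rule with index `i`. -/
def TrBdSat (P : Program α) (V : Set (TrVar α)) (δ : α → ℤ) (i : ℕ) (r : Rule α) : Prop :=
  if r.isConstraintRule then
    (if r.isWeighted then
       wSumPosV V r.bodyPos r.wPos + wSumNegV V r.bodyNeg r.wNeg ≤ r.lb - 1
     else (∃ b ∈ r.bodyPos, TrVar.atom b ∉ V) ∨ (∃ b ∈ r.bodyNeg, TrVar.atom b ∈ V))
  else
    ((tightHeads P r ≠ ∅ →
      ((if r.isWeighted then
          (r.lb ≤ wSumPosV V r.bodyPos r.wPos + wSumNegV V r.bodyNeg r.wNeg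
             ↔ TrVar.bd i ∈ V)
        else
          (((∀ b ∈ r.bodyPos, TrVar.atom b ∈ V) ∧ (∀ b ∈ r.bodyNeg, TrVar.atom b ∉ V))
             ↔ TrVar.bd i ∈ V)) ∧
       ∀ a ∈ tightHeads P r, 1 < (scc P a).card →
         sVal P a * b01 (TrVar.bd i ∈ V) + sVal P a * b01 (TrVar.atom a ∈ V) + δ a
           ≤ 2 * sVal P a + 1)) ∧
     (∀ a ∈ r.headAtoms, a ∉ tightHeads P r →
       if r.isWeighted then
         (r.lb ≤ extSum P V r a ↔ TrVar.ext i a ∈ V) ∧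
         (r.lb ≤ intSum P V r a ↔ TrVar.intv i a ∈ V) ∧
         (gapSum P V r a ≤ r.lb - 1 ↔ TrVar.auxv i a ∈ V) ∧
         (TrVar.ext i a ∈ V ∨ TrVar.auxv i a ∈ V ∨ TrVar.intv i a ∉ V) ∧
         (sVal P a * b01 (TrVar.ext i a ∈ V) + sVal P a * b01 (TrVar.atom a ∈ V) + δ a
            ≤ 2 * sVal P a + 1) ∧
         ((TrVar.ext i a ∈ V ∨ TrVar.intv i a ∈ V) ↔ TrVar.bda i a ∈ V)
       else
         (((∀ b ∈ r.bodyPos, b ∉ scc P a → TrVar.atom b ∈ V) ∧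
           (∀ b ∈ r.bodyPos, b ∈ scc P a → TrVar.dep a b ∈ V) ∧
           (∀ b ∈ r.bodyNeg, TrVar.atom b ∉ V)) ↔ TrVar.bda i a ∈ V) ∧
         (TrVar.bda i a ∉ V ∨ ∃ b ∈ r.bodyPos, b ∈ scc P a ∧ TrVar.gap a b ∉ V)))

/-- Satisfaction of the head translation `TrHd(r)` for the rule with index `i`. -/
def TrHdSat (P : Program α) (V : Set (TrVar α)) (i : ℕ) (r : Rule α) : Prop :=
  if r.isChoice = false ∧ 1 < r.headAtoms.card then
    (∀ a ∈ r.headAtoms,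
       ((TrVar.bd i ∈ V ∧ ∀ a' ∈ r.headAtoms, a' ≠ a → TrVar.atom a' ∉ V)
          ↔ TrVar.sp i a ∈ V)) ∧
    ((∃ a ∈ r.headAtoms, TrVar.atom a ∈ V) ∨ TrVar.bd i ∉ V)
  else
    ∀ a ∈ r.headAtoms,
      ((if ∀ b ∈ r.bodyPos, b ∉ scc P a then (TrVar.sp i a ∈ V ↔ TrVar.bd i ∈ V)
        else (TrVar.sp i a ∈ V ↔ TrVar.bda i a ∈ V)) ∧
       (r.isChoice = false → TrVar.sp i a ∈ V → TrVar.atom a ∈ V))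

/-- Satisfaction of `TrRule(r) = TrBd(r) ∪ TrHd(r)`. -/
def TrRuleSat (P : Program α) (V : Set (TrVar α)) (δ : α → ℤ) (i : ℕ) (r : Rule α) : Prop :=
  TrBdSat P V δ i r ∧ TrHdSat P V i r

/-- Satisfaction of the supportedness constraints `TrSupp(P)`. -/
def TrSuppSat (P : Program α) (V : Set (TrVar α)) : Prop :=
  ∀ a ∈ P.atoms,
    (∃ i, ∃ h : i < P.rules.length,
        a ∈ (P.rules.get ⟨i, h⟩).headAtoms ∧ TrVar.sp i a ∈ V)
    ∨ TrVar.atom a ∉ V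

/-- `⟨V, δ⟩` is a model of the complete translation `Tr(P)`. -/
def TrSat (P : Program α) (V : Set (TrVar α)) (δ : α → ℤ) : Prop :=
  levDomOK P δ ∧ TrRkSat P V δ ∧
  (∀ i, ∀ h : i < P.rules.length, TrRuleSat P V δ i (P.rules.get ⟨i, h⟩)) ∧
  TrSuppSat P V

/-- `I ∩ A_P`: the interpretation of `P` induced by the atom variables true in `V`. -/
noncomputable def atomInterp (P : Program α) (V : Set (TrVar α)) : Finset α :=
  P.atoms.filter (fun a => TrVar.atom a ∈ V)

/-- The Boolean variables actually occurring in the constraints of `Tr(P)`. -/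
def VarsOf (P : Program α) : Set (TrVar α) := fun v =>
  match v with
  | .atom a => a ∈ P.atoms
  | .dep a b => edge P a b ∧ b ∈ scc P a
  | .yv a b => edge P a b ∧ b ∈ scc P a
  | .gap a b => edge P a b ∧ b ∈ scc P a
  | .bd i => ∃ h : i < P.rules.length,
      ¬ (P.rules.get ⟨i, h⟩).isConstraintRule ∧
      (tightHeads P (P.rules.get ⟨i, h⟩) ≠ ∅ ∨
        ((P.rules.get ⟨i, h⟩).isChoice = false ∧ 1 < (P.rules.get ⟨i, h⟩).headAtoms.card))
  | .bda i a => ∃ h : i < P.rules.length,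
      a ∈ (P.rules.get ⟨i, h⟩).headAtoms ∧ a ∉ tightHeads P (P.rules.get ⟨i, h⟩)
  | .sp i a => ∃ h : i < P.rules.length, a ∈ (P.rules.get ⟨i, h⟩).headAtoms
  | .ext i a => ∃ h : i < P.rules.length,
      (P.rules.get ⟨i, h⟩).isWeighted = true ∧
      a ∈ (P.rules.get ⟨i, h⟩).headAtoms ∧ a ∉ tightHeads P (P.rules.get ⟨i, h⟩)
  | .intv i a => ∃ h : i < P.rules.length,
      (P.rules.get ⟨i, h⟩).isWeighted = true ∧
      a ∈ (P.rules.get ⟨i, h⟩).headAtoms ∧ a ∉ tightHeads P (P.rules.get ⟨i, h⟩)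
  | .auxv i a => ∃ h : i < P.rules.length,
      (P.rules.get ⟨i, h⟩).isWeighted = true ∧
      a ∈ (P.rules.get ⟨i, h⟩).headAtoms ∧ a ∉ tightHeads P (P.rules.get ⟨i, h⟩)

/-- The ranked assignment `δ′` induced by a model of `Tr(P)`:
`δ′(ℓ_a) = δ(ℓ_a)` for `a ∈ I` with `|SCC_P(a)| > 1`, `δ′(ℓ_a) = 1` for `a ∈ I`
with `|SCC_P(a)| = 1`, and `δ′(ℓ_a) = ∞` for atoms not in `I`. -/
noncomputable def liftRank (P : Program α) (V : Set (TrVar α)) (δ : α → ℤ) :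
    α → WithTop ℤ :=
  fun b =>
    if b ∈ atomInterp P V then
      (if 1 < (scc P b).card then ((δ b : ℤ) : WithTop ℤ) else 1)
    else ⊤


/-- Let `P` be HCF, `r ∈ P` a disjunctive rule with `H(r) = {a}`
or a choice rule with `a ∈ H(r)`, with a normal body and `SCC_P(a) ∩ B⁺(r) ≠ ∅`,
and let `⟨I, δ⟩` be a model of `Tr(P)`.  Then `bd_r^a ∈ I` iff `I ⊨ B(r)` and
`δ(ℓ_a) > max{δ(ℓ_b) : b ∈ B⁺(r) ∩ SCC_P(a)}` (the set being nonempty, the latter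
says `δ(ℓ_b) < δ(ℓ_a)` for all `b ∈ B⁺(r) ∩ SCC_P(a)`). -/
theorem statement3 (P : Program α) (hHCF : isHCF P) (hNT : noSelfLoops P)
    (i : ℕ) (hi : i < P.rules.length) (r : Rule α) (hr : r = P.rules.get ⟨i, hi⟩)
    (a : α)
    (hhead : (r.isChoice = false ∧ r.headAtoms = {a}) ∨
             (r.isChoice = true ∧ a ∈ r.headAtoms))
    (hnormal : r.isWeighted = false)
    (hscc : ∃ b ∈ r.bodyPos, b ∈ scc P a)
    (V : Set (TrVar α)) (δ : α → ℤ) (hM : TrSat P V δ) :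
    TrVar.bda i a ∈ V ↔
      (bodySat (atomInterp P V) r ∧ ∀ b ∈ r.bodyPos, b ∈ scc P a → δ b < δ a) := by
  have ha : a ∈ r.headAtoms := by
    rcases hhead with h | h
    · rw [h.2]; exact Finset.mem_singleton_self a
    · exact h.2
  have hrmem : r ∈ P.rules := by rw [hr]; exact List.get_mem _ _
  have hwf := P.wf r hrmem
  have haA : a ∈ P.atoms := hwf.1 ha
  have hedge : ∀ b ∈ r.bodyPos, edge P a b := fun b hb => ⟨r, hrmem, ha, hb⟩
  have haa : a ∈ scc P a := by
    unfold scc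
    exact Finset.mem_filter.2 ⟨haA, Relation.ReflTransGen.refl, Relation.ReflTransGen.refl⟩
  have hcard : 1 < (scc P a).card := by
    obtain ⟨b, hb, hbs⟩ := hscc
    refine Finset.one_lt_card.2 ⟨a, haa, b, hbs, ?_⟩
    rintro rfl
    exact hNT _ (hedge _ hb)
  have hsccEq : ∀ b ∈ scc P a, scc P b = scc P a := by
    intro b hb
    have h1 : sameSCC P a b := (Finset.mem_filter.1 hb).2
    ext c
    simp only [scc, Finset.mem_filter]
    constructor
    · rintro ⟨hc, h2⟩
      exact ⟨hc, h1.1.trans h2.1, h2.2.trans h1.2⟩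
    · rintro ⟨hc, h2⟩
      exact ⟨hc, h1.2.trans h2.1, h2.2.trans h1.1⟩
  obtain ⟨hdom, hrk, hrule, -⟩ := hM
  have hbd := (hrule i hi).1
  rw [← hr] at hbd
  unfold TrBdSat at hbd
  have hnc : ¬ r.isConstraintRule := by
    rintro ⟨-, h⟩
    rw [h] at ha
    exact Finset.notMem_empty a ha
  rw [if_neg hnc] at hbd
  have hnt : a ∉ tightHeads P r := by
    intro h
    obtain ⟨b, hb, hbs⟩ := hscc
    exact (Finset.mem_filter.1 h).2 b hb hbs
  have hb2 := hbd.2 a ha hnt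
  rw [if_neg (by simp [hnormal])] at hb2
  have hdep : ∀ b ∈ r.bodyPos, b ∈ scc P a → (TrVar.dep a b ∈ V ↔ δ b < δ a) := by
    intro b hb hbs
    rw [← ((hrk a haA hcard).2 b hbs (hedge b hb)).1]
    omega
  rw [← hb2.1]
  unfold bodySat
  rw [if_neg (by simp [hnormal])]
  unfold normalBodySat
  constructor
  · rintro ⟨h1, h2, h3⟩
    have hlt : ∀ b ∈ r.bodyPos, b ∈ scc P a → δ b < δ a :=
      fun b hb hbs => (hdep b hb hbs).1 (h2 b hb hbs)
    refine ⟨⟨?_, ?_⟩, hlt⟩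
    · intro b hb
      refine Finset.mem_filter.2 ⟨hwf.2.1 hb, ?_⟩
      by_cases hbs : b ∈ scc P a
      · have hc : 1 < (scc P b).card := by rw [hsccEq b hbs]; exact hcard
        refine (hrk b (hwf.2.1 hb) hc).1.1 ?_
        have h4 := (hdom a haA hcard).2
        have h5 := hlt b hb hbs
        unfold sVal at h4
        rw [hsccEq b hbs]
        omega
      · exact h1 b hb hbs
    · intro b hb hbI
      exact h3 b hb (Finset.mem_filter.1 hbI).2
  · rintro ⟨⟨h1, h2⟩, h3⟩
    refine ⟨fun b hb _ => (Finset.mem_filter.1 (h1 hb)).2,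
      fun b hb hbs => (hdep b hb hbs).2 (h3 b hb hbs), ?_⟩
    intro b hb hbV
    exact h2 b hb (Finset.mem_filter.2 ⟨hwf.2.2 hb, hbV⟩)

end AspFzn
end

section
/- Let P be a partially shifted head-cycle-free propositional ASP program and ⟨I, δ⟩ a model of Tr(P). Then for every rule r ∈ P, the interpretation I ∩ A_P satisfies r, i.e., I ∩ A_P ⊨ r. -/
/-!
Common framework: propositional ASP programs (disjunctive/choice heads,
normal/weighted bodies), FLP answer sets, dependency graph and SCCs,
(modular) ranked (scc-)supported models, and the asp-fzn translation `Tr(P)`.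
-/

namespace AspFzn

open scoped Classical

variable {α : Type} [DecidableEq α]

theorem mem_scc_iff (P : Program α) (a b : α) :
    b ∈ scc P a ↔ b ∈ P.atoms ∧ sameSCC P a b := by
  simp [scc]

theorem scc_eq_of_mem (P : Program α) {a b : α} (h : b ∈ scc P a) : scc P b = scc P a := by
  have h2 := ((mem_scc_iff P a b).1 h).2
  ext c
  rw [mem_scc_iff, mem_scc_iff]
  constructor
  · rintro ⟨hc, h3⟩
    exact ⟨hc, h2.1.trans h3.1, h3.2.trans h2.2⟩
  · rintro ⟨hc, h3⟩
    exact ⟨hc, h2.2.trans h3.1, h3.2.trans h2.1⟩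

theorem self_mem_scc (P : Program α) {a : α} (h : a ∈ P.atoms) : a ∈ scc P a :=
  (mem_scc_iff P a a).2 ⟨h, .refl, .refl⟩

/-- Under head-cycle freeness, a rule with at least two head atoms has a locally tight one. -/
theorem tight_nonempty (P : Program α) (hHCF : isHCF P) (r : Rule α) (hr : r ∈ P.rules)
    (hc : 1 < r.headAtoms.card) : tightHeads P r ≠ ∅ := by
  intro hT
  obtain ⟨a, ha, b, hb, hab⟩ := Finset.one_lt_card.1 hc
  have key : ∀ x ∈ r.headAtoms, ∃ c ∈ r.bodyPos, c ∈ scc P x := by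
    intro x hx
    by_contra hcon
    push Not at hcon
    have : x ∈ tightHeads P r := Finset.mem_filter.2 ⟨hx, hcon⟩
    rw [hT] at this
    simp at this
  obtain ⟨c, hcb, hcs⟩ := key a ha
  obtain ⟨d, hdb, hds⟩ := key b hb
  have hc2 := ((mem_scc_iff P a c).1 hcs).2
  have hd2 := ((mem_scc_iff P b d).1 hds).2
  have e1 : edge P a d := ⟨r, hr, ha, hdb⟩
  have e2 : edge P b c := ⟨r, hr, hb, hcb⟩
  exact hHCF r hr a ha b hb hab ((mem_scc_iff P a b).2
    ⟨(P.wf r hr).1 hb, .head e1 hd2.2, .head e2 hc2.2⟩)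

theorem normal_body_iff (P : Program α) (V : Set (TrVar α)) (r : Rule α) (hr : r ∈ P.rules)
    (h : normalBodySat (atomInterp P V) r) :
    (∀ b ∈ r.bodyPos, TrVar.atom b ∈ V) ∧ (∀ b ∈ r.bodyNeg, TrVar.atom b ∉ V) := by
  refine ⟨fun b hb => (Finset.mem_filter.1 (h.1 hb)).2, fun b hb hV => ?_⟩
  exact h.2 b hb (Finset.mem_filter.2 ⟨(P.wf r hr).2.2 hb, hV⟩)

theorem weighted_eq (P : Program α) (V : Set (TrVar α)) (r : Rule α) (hr : r ∈ P.rules) :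
    weightedVal (atomInterp P V) r
      = wSumPosV V r.bodyPos r.wPos + wSumNegV V r.bodyNeg r.wNeg := by
  unfold weightedVal wSumPosV wSumNegV
  congr 1
  · apply Finset.sum_congr _ (fun _ _ => rfl)
    ext b
    have := @(P.wf r hr).2.1 b
    simp only [Finset.mem_filter, atomInterp]
    tauto
  · apply Finset.sum_congr _ (fun _ _ => rfl)
    ext b
    have := @(P.wf r hr).2.2 b
    simp only [Finset.mem_filter, atomInterp]
    tauto

/-- If `a` is false, then `dep_{a,b}` is equivalent to `b` inside the component of `a`. -/
theorem dep_iff (P : Program α) (hNT : noSelfLoops P) (V : Set (TrVar α)) (δ : α → ℤ)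
    (hD : levDomOK P δ) (hR : TrRkSat P V δ) (a b : α) (ha : a ∈ P.atoms)
    (haV : TrVar.atom a ∉ V) (hb : b ∈ scc P a) (he : edge P a b) :
    TrVar.dep a b ∈ V ↔ TrVar.atom b ∈ V := by
  have hne : a ≠ b := by
    rintro rfl
    exact hNT a he
  have hcard : 1 < (scc P a).card :=
    Finset.one_lt_card.2 ⟨a, self_mem_scc P ha, b, hb, hne⟩
  have hbA := ((mem_scc_iff P a b).1 hb).1
  have hs := scc_eq_of_mem P hb
  obtain ⟨h1, h2⟩ := hR a ha hcard
  obtain ⟨h3, -⟩ := hR b hbA (by rw [hs]; exact hcard)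
  have h4 := (hD a ha hcard).2
  rw [hs] at h3
  rw [← (h2 b hb he).1, ← h3]
  have h5 : ¬ δ a ≤ ((scc P a).card : ℤ) := fun h => haV (h1.1 h)
  unfold sVal at h4
  omega

theorem intSum_eq (P : Program α) (V : Set (TrVar α)) (r : Rule α) (a : α)
    (h : ∀ b ∈ r.bodyPos, b ∈ scc P a → (TrVar.dep a b ∈ V ↔ TrVar.atom b ∈ V)) :
    intSum P V r a = wSumPosV V r.bodyPos r.wPos + wSumNegV V r.bodyNeg r.wNeg := by
  unfold intSum
  congr 1
  unfold wSumPosV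
  rw [← Finset.sum_filter_add_sum_filter_not (r.bodyPos.filter (fun b => TrVar.atom b ∈ V))
    (fun b => b ∉ scc P a)]
  congr 1
  · apply Finset.sum_congr _ (fun _ _ => rfl)
    ext b
    simp only [Finset.mem_filter]
    tauto
  · apply Finset.sum_congr _ (fun _ _ => rfl)
    ext b
    have := h b
    simp only [Finset.mem_filter]
    tauto

/-- Let `P` be a partially shifted HCF program and `⟨I, δ⟩` a model
of `Tr(P)`.  Then `I ∩ A_P ⊨ r` for every rule `r ∈ P`. -/
theorem statement8 (P : Program α) (hps : isPartiallyShifted P) (hHCF : isHCF P)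
    (hNT : noSelfLoops P)
    (V : Set (TrVar α)) (δ : α → ℤ) (hM : TrSat P V δ) :
    ∀ r ∈ P.rules, ruleSat (atomInterp P V) r := by
  obtain ⟨hD, hR, hRules, -⟩ := hM
  intro r hr hbody
  by_cases hch : r.isChoice = true
  · exact Or.inl hch
  have hch' : r.isChoice = false := by simpa using hch
  obtain ⟨⟨i, hi⟩, hri⟩ := List.get_of_mem hr
  have hrule := hRules i hi
  rw [hri] at hrule
  obtain ⟨hB, hH⟩ := hrule
  suffices hmain : ∃ a ∈ r.headAtoms, TrVar.atom a ∈ V by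
    obtain ⟨a, ha, haV⟩ := hmain
    exact Or.inr ⟨a, ha, Finset.mem_filter.2 ⟨(P.wf r hr).1 ha, haV⟩⟩
  unfold bodySat at hbody
  unfold TrBdSat at hB
  by_cases hcon : r.isConstraintRule
  · exfalso
    rw [if_pos hcon] at hB
    by_cases hw : r.isWeighted = true
    · rw [if_pos hw] at hB hbody
      rw [weighted_eq P V r hr] at hbody
      omega
    · rw [if_neg hw] at hB hbody
      obtain ⟨h1, h2⟩ := normal_body_iff P V r hr hbody
      rcases hB with ⟨b, hb, hbV⟩ | ⟨b, hb, hbV⟩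
      · exact hbV (h1 b hb)
      · exact h2 b hb hbV
  rw [if_neg hcon] at hB
  obtain ⟨hB1, hB2⟩ := hB
  have hbd : tightHeads P r ≠ ∅ → TrVar.bd i ∈ V := by
    intro hT
    obtain ⟨h1, -⟩ := hB1 hT
    by_cases hw : r.isWeighted = true
    · rw [if_pos hw] at h1 hbody
      rw [weighted_eq P V r hr] at hbody
      exact h1.1 hbody
    · rw [if_neg hw] at h1 hbody
      exact h1.1 (normal_body_iff P V r hr hbody)
  unfold TrHdSat at hH
  by_cases hc : r.isChoice = false ∧ 1 < r.headAtoms.card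
  · rw [if_pos hc] at hH
    rcases hH.2 with h | h
    · exact h
    · exact absurd (hbd (tight_nonempty P hHCF r hr hc.2)) h
  rw [if_neg hc] at hH
  have hne : r.headAtoms.Nonempty := by
    rw [Finset.nonempty_iff_ne_empty]
    exact fun h => hcon ⟨hch', h⟩
  obtain ⟨a, ha⟩ := hne
  refine ⟨a, ha, ?_⟩
  obtain ⟨hsp, hspa⟩ := hH a ha
  by_contra haV
  by_cases ht : ∀ b ∈ r.bodyPos, b ∉ scc P a
  · rw [if_pos ht] at hsp
    have haT : a ∈ tightHeads P r := Finset.mem_filter.2 ⟨ha, ht⟩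
    exact haV (hspa hch' (hsp.2 (hbd (Finset.ne_empty_of_mem haT))))
  rw [if_neg ht] at hsp
  have haT : a ∉ tightHeads P r := fun h => ht (Finset.mem_filter.1 h).2
  have hdep : ∀ b ∈ r.bodyPos, b ∈ scc P a → (TrVar.dep a b ∈ V ↔ TrVar.atom b ∈ V) :=
    fun b hb hbs => dep_iff P hNT V δ hD hR a b ((P.wf r hr).1 ha) haV hbs ⟨r, hr, ha, hb⟩
  have h2 := hB2 a ha haT
  refine haV (hspa hch' (hsp.2 ?_))
  by_cases hw : r.isWeighted = true
  · rw [if_pos hw] at h2 hbody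
    rw [weighted_eq P V r hr, ← intSum_eq P V r a hdep] at hbody
    obtain ⟨-, hint, -, -, -, hbda⟩ := h2
    exact hbda.1 (Or.inr (hint.1 hbody))
  · rw [if_neg hw] at h2 hbody
    obtain ⟨hp, hn⟩ := normal_body_iff P V r hr hbody
    exact h2.1.1 ⟨fun b hb _ => hp b hb, fun b hb hbs => (hdep b hb hbs).2 (hp b hb), hn⟩

end AspFzn
end
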